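/- arXiv:2012.08875 — 2 statements merged into one kernel-verified Lean document; each statement's English description precedes it below -/
import Mathlib

section
/- For every integer k ≥ 3 there exists α_0 > 0 such that for all α, ε with 0 < ε ≤ α ≤ α_0 there exists n_0 such that for all n ≥ n_0 the following holds: every 2-edge-coloured (1−ε, α)-dense k-graph H on n vertices has a 3√ε-blueprint G_* with V(G_*) = V(H) and |G_*| ≥ (1 − α − 24k√ε)·binom(n, k−2). -/
open Finset

/-- `degOn k H S W` is `d_H(S, W)`: the number of `(k - |S|)`-element subsets `e` of `W`
with `e ∪ S` an edge of the `k`-graph `H`. -/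
def degOn {V : Type*} [DecidableEq V] (k : ℕ) (H : Finset (Finset V)) (S W : Finset V) : ℕ :=
  ((W.powersetCard (k - S.card)).filter (fun e => e ∪ S ∈ H)).card

/-- `degT k H S` is `d_H(S) = d_H(S, V)`. -/
def degT {V : Type*} [Fintype V] [DecidableEq V] (k : ℕ) (H : Finset (Finset V))
    (S : Finset V) : ℕ :=
  degOn k H S Finset.univ

/-- A `k`-graph `H` on the vertex set `V` is `(μ, α)`-dense. -/
def IsDense {V : Type*} [Fintype V] [DecidableEq V] (k : ℕ) (H : Finset (Finset V))
    (μ α : ℝ) : Prop :=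
  ∀ i : ℕ, 1 ≤ i → i ≤ k - 1 →
    (({S : Finset V | S.card = i ∧
        (degT k H S : ℝ) < μ * ((Fintype.card V).choose (k - i))}.ncard : ℝ)
      ≤ α * ((Fintype.card V).choose i)) ∧
    ∀ S : Finset V, S.card = i →
      (degT k H S : ℝ) < μ * ((Fintype.card V).choose (k - i)) → degT k H S = 0

/-- Two edges `f, f'` of a `k`-graph `Hc` are tightly connected: there is a walk of edges,
consecutive ones sharing `k - 1` vertices. -/
def TightConn {V : Type*} [DecidableEq V] (k : ℕ) (Hc : Finset (Finset V)) (f f' : Finset V) : Prop :=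
  ∃ (t : ℕ) (e : ℕ → Finset V), e 0 = f ∧ e t = f' ∧ (∀ i ≤ t, e i ∈ Hc) ∧
    ∀ i < t, ((e i) ∩ (e (i + 1))).card = k - 1

/-- `C` is a tightly connected subgraph of the `k`-graph `Hc`. -/
def IsTCSub {V : Type*} [DecidableEq V] (k : ℕ) (Hc C : Finset (Finset V)) : Prop :=
  C ⊆ Hc ∧ ∀ f ∈ C, ∀ f' ∈ C, TightConn k Hc f f'

/-- `C` is a tight component (a maximal tightly connected subgraph) of the `k`-graph `Hc`. -/
def IsTightComponent {V : Type*} [DecidableEq V] (k : ℕ) (Hc C : Finset (Finset V)) : Prop :=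
  IsTCSub k Hc C ∧ ∀ C' : Finset (Finset V), IsTCSub k Hc C' → C ⊆ C' → C' = C

/-- The shadow of `H` consisting of all `r`-element sets contained in some edge of `H`. -/
def shadowTo {V : Type*} [Fintype V] [DecidableEq V] (r : ℕ) (H : Finset (Finset V)) :
    Finset (Finset V) :=
  ((Finset.univ : Finset V).powersetCard r).filter (fun e => ∃ f ∈ H, e ⊆ f)

/-- An `ε`-blueprint for a 2-edge-coloured `k`-graph `H` (with colouring `cH`, `true` = red):
a 2-edge-coloured `(k-2)`-graph together with the assignment `comp` of monochromatic tight
components, satisfying (BP1) and (BP2). -/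
structure Blueprint (k : ℕ) {V : Type*} [Fintype V] [DecidableEq V]
    (H : Finset (Finset V)) (cH : Finset V → Bool) (ε : ℝ) where
  verts : Finset V
  edges : Finset (Finset V)
  col : Finset V → Bool
  comp : Finset V → Finset (Finset V)
  edges_card : ∀ e ∈ edges, e.card = k - 2
  edges_sub : ∀ e ∈ edges, e ⊆ verts
  comp_is : ∀ e ∈ edges, IsTightComponent k (H.filter (fun f => cH f = col e)) (comp e)
  comp_deg : ∀ e ∈ edges,
    (1 - ε) * (Fintype.card V : ℝ) ≤ (degT (k - 1) (shadowTo (k - 1) (comp e)) e : ℝ)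
  comp_agree : ∀ e ∈ edges, ∀ e' ∈ edges, col e = col e' → (e ∩ e').card = k - 3 →
    comp e = comp e'

/-- For a subset `G'` of the edges of a blueprint `G`, the `k`-graph `(G')⁺`: all edges of
`⋃_{e ∈ G'} H(e)` containing some edge of `G'`. -/
def Blueprint.plus {k : ℕ} {V : Type*} [Fintype V] [DecidableEq V]
    {H : Finset (Finset V)} {cH : Finset V → Bool} {ε : ℝ}
    (G : Blueprint k H cH ε) (G' : Finset (Finset V)) : Finset (Finset V) :=
  (G'.biUnion (fun e => G.comp e)).filter (fun f => ∃ e ∈ G', e ⊆ f)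

/-- `M` is a matching: a set of pairwise disjoint edges. -/
def IsMatching {V : Type*} [DecidableEq V] (M : Finset (Finset V)) : Prop :=
  ∀ e ∈ M, ∀ f ∈ M, e ≠ f → Disjoint e f

/-- `M` is a tightly connected matching in the `k`-graph `Hc`. -/
def IsTCMatching {V : Type*} [DecidableEq V] (k : ℕ) (Hc M : Finset (Finset V)) : Prop :=
  M ⊆ Hc ∧ IsMatching M ∧ ∀ e ∈ M, ∀ f ∈ M, TightConn k Hc e f



section aux
set_option linter.unusedSectionVars false
variable {V : Type*} [Fintype V] [DecidableEq V]


theorem tc_refl {k : ℕ} {Hc : Finset (Finset V)} {f : Finset V} (hf : f ∈ Hc) :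
    TightConn k Hc f f :=
  ⟨0, fun _ => f, rfl, rfl, fun _ _ => hf, fun i hi => absurd hi (by omega)⟩

theorem tc_symm {k : ℕ} {Hc : Finset (Finset V)} {f g : Finset V}
    (h : TightConn k Hc f g) : TightConn k Hc g f := by
  obtain ⟨t, e, h0, ht, hm, hs⟩ := h
  refine ⟨t, fun i => e (t - i), by simpa using ht, by simpa using h0,
    fun i _ => hm _ (by omega), fun i hi => ?_⟩
  have := hs (t - (i + 1)) (by omega)
  rw [Finset.inter_comm]
  rwa [show t - (i + 1) + 1 = t - i by omega] at this

theorem tc_step {k : ℕ} {Hc : Finset (Finset V)} {f g h : Finset V}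
    (hfg : TightConn k Hc f g) (hh : h ∈ Hc) (hc : (g ∩ h).card = k - 1) :
    TightConn k Hc f h := by
  obtain ⟨t, e, h0, ht, hm, hs⟩ := hfg
  refine ⟨t + 1, fun i => if i ≤ t then e i else h, by simpa using h0, by simp, ?_, ?_⟩
  · intro i hi
    by_cases h1 : i ≤ t
    · simpa [h1] using hm i h1
    · simpa [h1] using hh
  · intro i hi
    by_cases h1 : i + 1 ≤ t
    · have h2 : i ≤ t := by omega
      simpa [h1, h2] using hs i (by omega)
    · have h2 : i = t := by omega
      subst h2
      simpa [ht] using hc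

theorem tc_trans {k : ℕ} {Hc : Finset (Finset V)} {f g h : Finset V}
    (hfg : TightConn k Hc f g) (hgh : TightConn k Hc g h) :
    TightConn k Hc f h := by
  obtain ⟨t, e, h0, ht, hm, hs⟩ := hgh
  have : ∀ i ≤ t, TightConn k Hc f (e i) := by
    intro i
    induction i with
    | zero => intro _; rwa [h0]
    | succ i ih => intro hi; exact tc_step (ih (by omega)) (hm _ hi) (hs i (by omega))
  have := this t le_rfl
  rwa [ht] at this

open Classical in
/-- The tight component of an edge. -/
noncomputable def tcomp (k : ℕ) (Hc : Finset (Finset V)) (f : Finset V) : Finset (Finset V) :=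
  Hc.filter (fun g => TightConn k Hc f g)

theorem mem_tcomp {k : ℕ} {Hc : Finset (Finset V)} {f g : Finset V} :
    g ∈ tcomp k Hc f ↔ g ∈ Hc ∧ TightConn k Hc f g := by
  classical
  simp [tcomp]

theorem tcomp_is {k : ℕ} {Hc : Finset (Finset V)} {f : Finset V} (hf : f ∈ Hc) :
    IsTightComponent k Hc (tcomp k Hc f) := by
  refine ⟨⟨fun g hg => (mem_tcomp.1 hg).1, fun g hg g' hg' =>
    tc_trans (tc_symm (mem_tcomp.1 hg).2) (mem_tcomp.1 hg').2⟩, ?_⟩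
  intro C' hC' hsub
  refine Finset.Subset.antisymm (fun g hg => ?_) hsub
  have hfC : f ∈ C' := hsub (mem_tcomp.2 ⟨hf, tc_refl hf⟩)
  exact mem_tcomp.2 ⟨hC'.1 hg, hC'.2 f hfC g hg⟩

/-- Components sharing connected edges coincide. -/
theorem comp_mem {k : ℕ} {Hc C : Finset (Finset V)} (hC : IsTightComponent k Hc C)
    {f g : Finset V} (hf : f ∈ C) (hg : g ∈ Hc) (h : TightConn k Hc f g) : g ∈ C := by
  have hsub : C ⊆ tcomp k Hc f := fun x hx => mem_tcomp.2 ⟨hC.1.1 hx, hC.1.2 f hf x hx⟩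
  have := hC.2 _ (tcomp_is (hC.1.1 hf)).1 hsub
  rw [← this]
  exact mem_tcomp.2 ⟨hg, h⟩

theorem comp_eq {k : ℕ} {Hc C C' : Finset (Finset V)} (hC : IsTightComponent k Hc C)
    (hC' : IsTightComponent k Hc C')
    {f g : Finset V} (hf : f ∈ C) (hg : g ∈ C') (h : TightConn k Hc f g) : C = C' := by
  apply Finset.Subset.antisymm
  · intro x hx
    exact comp_mem hC' hg (hC.1.1 hx) (tc_trans (tc_symm h) (hC.1.2 f hf x hx))
  · intro x hx
    exact comp_mem hC hf (hC'.1.1 hx) (tc_trans h (hC'.1.2 g hg x hx))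

/-- Two edges containing a common `(k-1)`-set are tightly connected. -/
theorem tc_of_common {k : ℕ} {Hc : Finset (Finset V)} (hu : ∀ e ∈ Hc, e.card = k)
    {f g U : Finset V} (hf : f ∈ Hc) (hg : g ∈ Hc) (hU : U.card = k - 1)
    (hUf : U ⊆ f) (hUg : U ⊆ g) : TightConn k Hc f g := by
  by_cases hfg : f = g
  · subst hfg; exact tc_refl hf
  · refine tc_step (tc_refl hf) hg ?_
    have h1 : U.card ≤ (f ∩ g).card := Finset.card_le_card (Finset.subset_inter hUf hUg)
    have h2 : (f ∩ g).card < k := by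
      rw [← hu f hf]
      apply Finset.card_lt_card
      refine Finset.ssubset_iff_subset_ne.2 ⟨Finset.inter_subset_left, fun h => hfg ?_⟩
      exact Finset.eq_of_subset_of_card_le (Finset.inter_eq_left.1 h) (by rw [hu f hf, hu g hg])
    omega

theorem degT_one {r : ℕ} (H : Finset (Finset V)) {S : Finset V} (h : r - S.card = 1) :
    degT r H S = (Finset.univ.filter (fun y => insert y S ∈ H)).card := by
  unfold degT degOn
  rw [h, Finset.powersetCard_one, Finset.filter_map, Finset.card_map]
  rfl


open Classical in
theorem lemmaA (G : Bool → SimpleGraph V) (A : Finset V) (d : ℕ)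
    (hd : ∀ x ∈ A, (A.filter (fun y => ¬ ((G true).Adj x y ∨ (G false).Adj x y))).card ≤ d)
    (hA : 6 * d < A.card) :
    ∃ c, ∃ v ∈ A, (A.filter (fun y => ¬ (G c).Reachable v y)).card ≤ 2 * d := by
  by_contra hcon
  push Not at hcon
  have key : ∀ x ∈ A, ∀ y ∈ A, ∀ B ⊆ A, 2 * d < B.card →
      (∃ z ∈ B, ((G true).Adj x z ∨ (G false).Adj x z) ∧
        ((G true).Adj y z ∨ (G false).Adj y z)) := by
    intro x hx y hy B hB hBc
    by_contra hno
    push Not at hno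
    have hsub : B ⊆ (A.filter (fun z => ¬ ((G true).Adj x z ∨ (G false).Adj x z))) ∪
        (A.filter (fun z => ¬ ((G true).Adj y z ∨ (G false).Adj y z))) := by
      intro z hz
      have := hno z hz
      simp only [Finset.mem_union, Finset.mem_filter]
      by_cases h1 : ((G true).Adj x z ∨ (G false).Adj x z)
      · right; exact ⟨hB hz, fun h => by have := this h1; tauto⟩
      · left; exact ⟨hB hz, h1⟩
    have h1 := Finset.card_le_card hsub
    have h2 := Finset.card_union_le (A.filter (fun z => ¬ ((G true).Adj x z ∨ (G false).Adj x z)))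
        (A.filter (fun z => ¬ ((G true).Adj y z ∨ (G false).Adj y z)))
    have h3 := hd x hx
    have h4 := hd y hy
    omega
  by_cases hbig : ∃ v ∈ A, 2 * d < (A.filter (fun y => (G true).Reachable v y)).card
  · obtain ⟨v, hv, hvR⟩ := hbig
    have hB := hcon true v hv
    set R := A.filter (fun y => (G true).Reachable v y) with hR
    set B := A.filter (fun y => ¬ (G true).Reachable v y) with hBdef
    have cross : ∀ x ∈ R, ∀ z ∈ B, ((G true).Adj x z ∨ (G false).Adj x z) → (G false).Adj x z := by
      intro x hx z hz h
      rcases h with h | h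
      · exact absurd ((Finset.mem_filter.1 hx).2.trans h.reachable) (Finset.mem_filter.1 hz).2
      · exact h
    have hvRm : v ∈ R := Finset.mem_filter.2 ⟨hv, SimpleGraph.Reachable.refl _⟩
    have hRR : ∀ x ∈ R, (G false).Reachable v x := by
      intro x hx
      obtain ⟨z, hz, h1, h2⟩ := key v hv x (Finset.mem_filter.1 hx).1 B (Finset.filter_subset _ _) hB
      exact (cross v hvRm z hz h1).reachable.trans (cross x hx z hz h2).reachable.symm
    have hall : ∀ x ∈ A, (G false).Reachable v x := by
      intro x hx
      by_cases hxR : (G true).Reachable v x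
      · exact hRR x (Finset.mem_filter.2 ⟨hx, hxR⟩)
      · have hxB : x ∈ B := Finset.mem_filter.2 ⟨hx, hxR⟩
        obtain ⟨z, hz, h1, _⟩ := key x hx x hx R (Finset.filter_subset _ _) hvR
        have := cross z hz x hxB (by rcases h1 with h | h; exacts [Or.inl h.symm, Or.inr h.symm])
        exact (hRR z hz).trans this.reachable
    have h0 := hcon false v hv
    rw [Finset.filter_false_of_mem (fun x hx => not_not.2 (hall x hx))] at h0
    simp at h0
  · push Not at hbig
    obtain ⟨v, hv⟩ : A.Nonempty := Finset.card_pos.1 (by omega)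
    have hall : ∀ x ∈ A, (G false).Reachable v x := by
      intro x hx
      set B := A.filter (fun y => ¬ ((G true).Reachable v y ∨ (G true).Reachable x y)) with hBdef
      have hBc : 2 * d < B.card := by
        have h1 : ((A.filter (fun y => (G true).Reachable v y)) ∪
            (A.filter (fun y => (G true).Reachable x y))).card + B.card = A.card := by
          rw [← Finset.filter_or, hBdef]
          convert Finset.card_filter_add_card_filter_not (s := A)
            (fun y => ((G true).Reachable v y ∨ (G true).Reachable x y))
        have h2 := Finset.card_union_le (A.filter (fun y => (G true).Reachable v y))
          (A.filter (fun y => (G true).Reachable x y))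
        have h3 := hbig v hv
        have h4 := hbig x hx
        omega
      obtain ⟨z, hz, h1, h2⟩ := key v hv x hx B (Finset.filter_subset _ _) hBc
      have hz' := (Finset.mem_filter.1 hz).2
      push Not at hz'
      have h1' : (G false).Adj v z := h1.resolve_left fun h => hz'.1 h.reachable
      have h2' : (G false).Adj x z := h2.resolve_left fun h => hz'.2 h.reachable
      exact h1'.reachable.trans h2'.reachable.symm
    have h0 := hcon false v hv
    rw [Finset.filter_false_of_mem (fun x hx => not_not.2 (hall x hx))] at h0
    simp at h0

/-- Lemma B: nearly all elements share the same value. -/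
theorem lemmaB {β : Type*} [DecidableEq β] [Inhabited β] (X : Finset V) (f : V → β)
    (N : V → Finset V) (m : ℕ)
    (hN : ∀ x ∈ X, (N x).card ≤ m)
    (h : ∀ x ∈ X, ∀ y ∈ X, f x ≠ f y → y ∈ N x ∨ x ∈ N y) :
    ∃ b, (X.filter (fun x => f x ≠ b)).card ≤ 2 * m := by
  rcases X.eq_empty_or_nonempty with rfl | hX
  · exact ⟨default, by simp⟩
  by_contra hcon
  push Not at hcon
  have h1 : ∑ x ∈ X, (2 * m) < ∑ x ∈ X, (X.filter (fun y => f y ≠ f x)).card :=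
    Finset.sum_lt_sum_of_nonempty hX fun x _ => hcon (f x)
  have h2 : ∀ x ∈ X, (X.filter (fun y => f y ≠ f x)).card ≤
      (X.filter (fun y => y ∈ N x)).card + (X.filter (fun y => x ∈ N y)).card := by
    intro x hx
    refine le_trans (Finset.card_le_card ?_) (Finset.card_union_le _ _)
    intro y hy
    rw [Finset.mem_filter] at hy
    simp only [Finset.mem_union, Finset.mem_filter]
    rcases h x hx y hy.1 (Ne.symm hy.2) with h | h
    · exact Or.inl ⟨hy.1, h⟩
    · exact Or.inr ⟨hy.1, h⟩
  have h3 := Finset.sum_le_sum h2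
  rw [Finset.sum_add_distrib] at h3
  have h4 : ∑ x ∈ X, (X.filter (fun y => x ∈ N y)).card =
      ∑ x ∈ X, (X.filter (fun y => y ∈ N x)).card :=
    Finset.sum_card_bipartiteAbove_eq_sum_card_bipartiteBelow (fun x y => x ∈ N y)
  have h5 : ∑ x ∈ X, (X.filter (fun y => y ∈ N x)).card ≤ ∑ x ∈ X, m := by
    refine Finset.sum_le_sum fun x hx => le_trans (Finset.card_le_card ?_) (hN x hx)
    intro y hy
    exact (Finset.mem_filter.1 hy).2
  rw [← Finset.mul_sum] at h1
  omega

theorem exists_comp {k : ℕ} (hk : 3 ≤ k) (H : Finset (Finset V)) (cH : Finset V → Bool)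
    (hu : ∀ e ∈ H, e.card = k) (ε s : ℝ) (hε : 0 < ε) (hε1 : ε ≤ 1 / 10) (hs : ε ≤ s)
    (hn : 10 ≤ Fintype.card V)
    (hdeg : ∀ T : Finset V, T.card = k - 1 →
      (degT k H T : ℝ) < (1 - ε) * (Fintype.card V : ℝ) → degT k H T = 0)
    (S : Finset V) (hS : S.card = k - 2) (hS0 : degT k H S ≠ 0) :
    ∃ c C, IsTightComponent k (H.filter (fun f => cH f = c)) C ∧
      (1 - 3 * s) * (Fintype.card V : ℝ) ≤ (degT (k - 1) (shadowTo (k - 1) C) S : ℝ) := by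
  classical
  set n := Fintype.card V with hndef
  have hnR : (10 : ℝ) ≤ (n : ℝ) := by exact_mod_cast hn
  -- cardinalities
  have hcard1 : ∀ {x y : V}, insert y (insert x S) ∈ H → (insert x S).card = k - 1 ∧ x ∉ S := by
    intro x y h
    have h1 := hu _ h
    have h2 := Finset.card_insert_le y (insert x S)
    have h3 := Finset.card_insert_le x S
    refine ⟨by omega, fun hx => ?_⟩
    rw [Finset.insert_eq_of_mem hx] at h2 h1
    omega
  have hne : ∀ {x y : V}, insert y (insert x S) ∈ H → y ≠ x := by
    intro x y h e
    have h1 := hu _ h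
    have h2 := (hcard1 h).1
    subst e
    rw [Finset.insert_idem] at h1
    omega
  -- the active vertices
  set A : Finset V := univ.filter (fun x => ∃ y, insert y (insert x S) ∈ H) with hAdef
  set nb : V → Finset V := fun x => univ.filter (fun y => insert y (insert x S) ∈ H) with hnb
  have hnbA : ∀ x, nb x ⊆ A := by
    intro x y hy
    simp only [hnb, hAdef, Finset.mem_filter, Finset.mem_univ, true_and] at hy ⊢
    exact ⟨x, by rwa [Finset.insert_comm]⟩
  have hnbc : ∀ x ∈ A, (1 - ε) * (n : ℝ) ≤ ((nb x).card : ℝ) := by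
    intro x hx
    obtain ⟨y, hy⟩ := (Finset.mem_filter.1 hx).2
    have hc := (hcard1 hy).1
    have he := degT_one (r := k) H (S := insert x S) (by omega)
    have hpos : degT k H (insert x S) ≠ 0 := by
      rw [he]
      exact Finset.card_ne_zero_of_mem (a := y) (by simpa using hy)
    by_contra hlt
    push Not at hlt
    refine hpos (hdeg _ hc ?_)
    rw [he]; exact hlt
  have hAne : A.Nonempty := by
    have : 0 < degT k H S := Nat.pos_of_ne_zero hS0
    unfold degT degOn at this
    obtain ⟨p, hp⟩ := Finset.card_pos.1 this
    rw [Finset.mem_filter, Finset.mem_powersetCard, show k - S.card = 2 by omega,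
      Finset.card_eq_two] at hp
    obtain ⟨⟨_, a, b, hab, rfl⟩, hp⟩ := hp
    refine ⟨b, ?_⟩
    simp only [hAdef, Finset.mem_filter, Finset.mem_univ, true_and]
    refine ⟨a, ?_⟩
    convert hp using 1
    ext z; simp
  have hAc : (1 - ε) * (n : ℝ) ≤ (A.card : ℝ) := by
    obtain ⟨x, hx⟩ := hAne
    exact (hnbc x hx).trans (by exact_mod_cast Finset.card_le_card (hnbA x))
  set d : ℕ := ⌊ε * n⌋₊ with hd
  have hdle : (d : ℝ) ≤ ε * n := Nat.floor_le (by positivity)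
  -- the coloured link graphs
  let G : Bool → SimpleGraph V := fun c =>
    { Adj := fun x y => insert y (insert x S) ∈ H.filter (fun f => cH f = c)
      symm := ⟨fun x y h => by rwa [Finset.insert_comm]⟩
      loopless := ⟨fun x h => hne (Finset.mem_filter.1 h).1 rfl⟩ }
  have hGadj : ∀ c x y, (G c).Adj x y ↔ insert y (insert x S) ∈ H.filter (fun f => cH f = c) :=
    fun _ _ _ => Iff.rfl
  obtain ⟨c, v, hv, hvc⟩ := lemmaA G A d (by
    intro x hx
    have hsub : A.filter (fun y => ¬ ((G true).Adj x y ∨ (G false).Adj x y)) ⊆ univ \ nb x := by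
      intro y hy
      have hy' := (Finset.mem_filter.1 hy).2
      simp only [Finset.mem_sdiff, Finset.mem_univ, true_and]
      intro hyn
      apply hy'
      have hyH := (Finset.mem_filter.1 hyn).2
      rw [hGadj, hGadj, Finset.mem_filter, Finset.mem_filter]
      cases hcc : cH (insert y (insert x S))
      · right; exact ⟨hyH, rfl⟩
      · left; exact ⟨hyH, rfl⟩
    have h1 := Finset.card_le_card hsub
    rw [Finset.card_sdiff_of_subset (Finset.subset_univ _), Finset.card_univ] at h1
    have h2 : (nb x).card ≤ Fintype.card V := Finset.card_le_univ _
    have h3 : Fintype.card V - (nb x).card ≤ d := by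
      refine Nat.le_floor ?_
      rw [Nat.cast_sub h2]
      have := hnbc x hx
      linarith
    have h4 := Nat.le_trans h1 h3
    convert h4) (by
    have : (6 * d : ℝ) < A.card := by nlinarith
    exact_mod_cast this)
  have hsplit := Finset.card_filter_add_card_filter_not (s := A) (fun y => (G c).Reachable v y)
  have hsplitR : ((A.filter (fun y => (G c).Reachable v y)).card : ℝ) +
      ((A.filter (fun y => ¬ (G c).Reachable v y)).card : ℝ) = A.card := by exact_mod_cast hsplit
  have hvcR : ((A.filter (fun y => ¬ (G c).Reachable v y)).card : ℝ) ≤ 2 * d := by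
    have hvc' : (A.filter (fun y => ¬ (G c).Reachable v y)).card ≤ 2 * d := by
      convert hvc
    exact_mod_cast hvc'
  have hbig : (1 - 3 * ε) * n ≤ ((A.filter (fun y => (G c).Reachable v y)).card : ℝ) := by
    nlinarith
  have hgt1 : 1 < (A.filter (fun y => (G c).Reachable v y)).card := by
    have : (1 : ℝ) < ((A.filter (fun y => (G c).Reachable v y)).card : ℝ) := by nlinarith
    exact_mod_cast this
  obtain ⟨y, hy, hyv⟩ := Finset.exists_mem_ne hgt1 v
  obtain ⟨w, hw⟩ : ∃ w, (G c).Adj v w := by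
    obtain ⟨p⟩ := (Finset.mem_filter.1 hy).2
    cases p with
    | nil => exact absurd rfl hyv
    | cons h _ => exact ⟨_, h⟩
  set Hc := H.filter (fun f => cH f = c) with hHc
  have huc : ∀ e ∈ Hc, e.card = k := fun e he => hu e (Finset.mem_filter.1 he).1
  refine ⟨c, tcomp k Hc (insert w (insert v S)), tcomp_is hw, ?_⟩
  have hreach : ∀ z, (G c).Reachable v z →
      ∃ g ∈ tcomp k Hc (insert w (insert v S)), insert z S ⊆ g := by
    intro z hz
    rw [SimpleGraph.reachable_iff_reflTransGen] at hz
    induction hz with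
    | refl => exact ⟨_, mem_tcomp.2 ⟨hw, tc_refl hw⟩, Finset.subset_insert _ _⟩
    | @tail a b hab hb ih =>
      obtain ⟨g, hg, hsub⟩ := ih
      refine ⟨insert b (insert a S), ?_, ?_⟩
      · rw [hGadj] at hb
        rw [mem_tcomp] at hg ⊢
        exact ⟨hb, tc_trans hg.2 (tc_of_common huc hg.1 hb
          (hcard1 (Finset.mem_filter.1 hb).1).1 hsub (Finset.subset_insert _ _))⟩
      · exact Finset.insert_subset_insert _ (Finset.subset_insert _ _)
  rw [degT_one _ (by omega)]
  have hsub : A.filter (fun y => (G c).Reachable v y) ⊆ univ.filter (fun y => insert y S ∈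
      shadowTo (k - 1) (tcomp k Hc (insert w (insert v S)))) := by
    intro z hz
    obtain ⟨hzA, hzr⟩ := Finset.mem_filter.1 hz
    obtain ⟨u, hu'⟩ := (Finset.mem_filter.1 hzA).2
    simp only [shadowTo, Finset.mem_filter, Finset.mem_univ, true_and, Finset.mem_powersetCard,
      Finset.subset_univ]
    exact ⟨(hcard1 hu').1, hreach z hzr⟩
  have hle : ((A.filter (fun y => (G c).Reachable v y)).card : ℝ) ≤ _ :=
    Nat.cast_le.2 (Finset.card_le_card hsub)
  refine le_trans ?_ hle
  refine le_trans ?_ hbig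
  nlinarith

end aux
/-- For every `k ≥ 3` there is `α₀ > 0` such that for all `0 < ε ≤ α ≤ α₀` there is `n₀` such
that for all `n ≥ n₀`: every 2-edge-coloured `(1-ε, α)`-dense `k`-graph `H` on `n` vertices
has a `3√ε`-blueprint `G⋆` with `V(G⋆) = V(H)` and `|G⋆| ≥ (1 - α - 24k√ε) C(n, k-2)`. -/
theorem stmt8 (k : ℕ) (hk : 3 ≤ k) :
    ∃ α₀ : ℝ, 0 < α₀ ∧ ∀ α ε : ℝ, 0 < ε → ε ≤ α → α ≤ α₀ →
      ∃ n₀ : ℕ, ∀ n : ℕ, n₀ ≤ n →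
        ∀ (H : Finset (Finset (Fin n))) (cH : Finset (Fin n) → Bool),
          (∀ e ∈ H, e.card = k) → IsDense k H (1 - ε) α →
          ∃ G : Blueprint k H cH (3 * Real.sqrt ε),
            G.verts = Finset.univ ∧
            (1 - α - 24 * (k : ℝ) * Real.sqrt ε) * (n.choose (k - 2) : ℝ) ≤
              (G.edges.card : ℝ) := by
  classical
  refine ⟨1, one_pos, fun α ε hε hεα hα => ⟨10 + 2 * k, fun n hn H cH hu hD => ?_⟩⟩
  set s := Real.sqrt ε with hs
  have hs0 : 0 < s := Real.sqrt_pos.2 hε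
  have hss : s * s = ε := Real.mul_self_sqrt hε.le
  by_cases htriv : 1 - α - 24 * (k : ℝ) * s ≤ 0
  · refine ⟨⟨univ, ∅, fun _ => true, fun _ => ∅, by simp, by simp, by simp, by simp, by simp⟩,
      rfl, ?_⟩
    simp only [Finset.card_empty, Nat.cast_zero]
    exact mul_nonpos_of_nonpos_of_nonneg htriv (by positivity)
  push Not at htriv
  have hkR : (3 : ℝ) ≤ k := by exact_mod_cast hk
  have hs1 : 72 * s < 1 := by nlinarith
  have hεs : ε ≤ s := by nlinarith
  have hnR : (10 : ℝ) + 2 * k ≤ n := by exact_mod_cast hn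
  have hcomp := fun S hS hS0 => exists_comp hk H cH hu ε s hε (by linarith) hεs
    (by rw [Fintype.card_fin]; omega)
    (by
      intro T hT hlt
      refine (hD (k - 1) (by omega) le_rfl).2 T hT ?_
      rw [show k - (k - 1) = 1 by omega, Nat.choose_one_right]
      exact hlt) S hS hS0
  choose! col comp hC hCdeg using hcomp
  rw [Fintype.card_fin] at hCdeg
  set E0 := ((univ : Finset (Fin n)).powersetCard (k - 2)).filter (fun S => degT k H S ≠ 0) with hE0
  have hE0m : ∀ {S}, S ∈ E0 → S.card = k - 2 ∧ degT k H S ≠ 0 := by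
    intro S hS
    rw [hE0, Finset.mem_filter, Finset.mem_powersetCard] at hS
    exact ⟨hS.1.2, hS.2⟩
  set m : ℕ := ⌊3 * s * n⌋₊ with hm
  have hmle : (m : ℝ) ≤ 3 * s * n := Nat.floor_le (by positivity)
  let X : Finset (Fin n) → Bool → Finset (Fin n) := fun T c =>
    univ.filter (fun x => x ∉ T ∧ insert x T ∈ E0 ∧ col (insert x T) = c)
  have hX : ∀ {T c x}, x ∈ X T c ↔ x ∉ T ∧ insert x T ∈ E0 ∧ col (insert x T) = c := by
    intro T c x; simp [X]
  have hB : ∀ T : Finset (Fin n), T.card = k - 3 → ∀ c, ∃ b : Finset (Finset (Fin n)),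
      ((X T c).filter (fun x => comp (insert x T) ≠ b)).card ≤ 2 * m := by
    intro T hT c
    refine lemmaB (X T c) (fun x => comp (insert x T))
      (fun x => univ.filter (fun y =>
        ¬ insert y (insert x T) ∈ shadowTo (k - 1) (comp (insert x T)))) m ?_ ?_
    · intro x hx
      obtain ⟨h1, h2, h3⟩ := hX.1 hx
      obtain ⟨h4, h5⟩ := hE0m h2
      have h6 := hCdeg _ h4 h5
      rw [degT_one _ (by omega)] at h6
      have h7 := Finset.card_filter_add_card_filter_not (s := (univ : Finset (Fin n)))
        (fun y => insert y (insert x T) ∈ shadowTo (k - 1) (comp (insert x T)))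
      rw [Finset.card_univ, Fintype.card_fin] at h7
      refine Nat.le_floor ?_
      have h8 : ((univ.filter (fun y => insert y (insert x T) ∈
          shadowTo (k - 1) (comp (insert x T)))).card : ℝ) + ((univ.filter (fun y =>
        ¬ insert y (insert x T) ∈ shadowTo (k - 1) (comp (insert x T)))).card : ℝ) = n := by
        exact_mod_cast h7
      linarith
    · intro x hx y hy hne
      by_contra hno
      simp only [Finset.mem_filter, Finset.mem_univ, true_and, not_or, not_not] at hno
      obtain ⟨h1, h2, h3⟩ := hX.1 hx
      obtain ⟨h1', h2', h3'⟩ := hX.1 hy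
      obtain ⟨h4, h5⟩ := hE0m h2
      obtain ⟨h4', h5'⟩ := hE0m h2'
      have hc := hC _ h4 h5
      have hc' := hC _ h4' h5'
      rw [h3] at hc
      rw [h3'] at hc'
      obtain ⟨ha, hb⟩ := hno
      simp only [shadowTo, Finset.mem_filter, Finset.mem_powersetCard] at ha hb
      obtain ⟨⟨_, hU⟩, g, hg, hUg⟩ := ha
      obtain ⟨_, g', hg', hUg'⟩ := hb
      rw [Finset.insert_comm] at hUg'
      exact hne (comp_eq hc hc' hg hg' (tc_of_common
        (fun e he => hu e (Finset.mem_filter.1 he).1) (hc.1.1 hg) (hc'.1.1 hg') hU hUg hUg'))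
  choose! b hb using hB
  set Del : Finset (Finset (Fin n)) := ((univ : Finset (Fin n)).powersetCard (k - 3)).biUnion
    (fun T => (univ : Finset Bool).biUnion (fun c =>
      ((X T c).filter (fun x => comp (insert x T) ≠ b T c)).image (fun x => insert x T))) with hDel
  have hDelc : Del.card ≤ n.choose (k - 3) * (2 * (2 * m)) := by
    have h1 : ((univ : Finset (Fin n)).powersetCard (k - 3)).card = n.choose (k - 3) := by simp
    rw [← h1]
    refine Finset.card_biUnion_le_card_mul _ _ _ fun T hT => ?_
    have h2 : (univ : Finset Bool).card = 2 := by simp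
    nth_rewrite 1 [← h2]
    refine Finset.card_biUnion_le_card_mul _ _ _ fun c _ => ?_
    exact Finset.card_image_le.trans (hb T (Finset.mem_powersetCard.1 hT).2 c)
  have hval : ∀ T x, T.card = k - 3 → x ∉ T → insert x T ∈ E0 \ Del →
      comp (insert x T) = b T (col (insert x T)) := by
    intro T x hT hx he
    rw [Finset.mem_sdiff] at he
    by_contra hne
    apply he.2
    rw [hDel, Finset.mem_biUnion]
    refine ⟨T, Finset.mem_powersetCard.2 ⟨Finset.subset_univ _, hT⟩, ?_⟩
    rw [Finset.mem_biUnion]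
    refine ⟨col (insert x T), Finset.mem_univ _, Finset.mem_image.2 ⟨x, ?_, rfl⟩⟩
    exact Finset.mem_filter.2 ⟨hX.2 ⟨hx, he.1, rfl⟩, hne⟩
  have hrep : ∀ e T : Finset (Fin n), e.card = k - 2 → T.card = k - 3 → T ⊆ e →
      ∃ x, x ∉ T ∧ insert x T = e := by
    intro e T he hT hTe
    have h1 : (e \ T).card = 1 := by rw [Finset.card_sdiff_of_subset hTe]; omega
    obtain ⟨x, hx⟩ := Finset.card_eq_one.1 h1
    have hx' : x ∈ e \ T := by simp [hx]
    refine ⟨x, (Finset.mem_sdiff.1 hx').2, ?_⟩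
    rw [Finset.insert_eq, ← hx, Finset.sdiff_union_of_subset hTe]
  have hEm : ∀ {e}, e ∈ E0 \ Del → e.card = k - 2 ∧ degT k H e ≠ 0 :=
    fun he => hE0m (Finset.mem_sdiff.1 he).1
  refine ⟨⟨univ, E0 \ Del, col, comp, fun e he => (hEm he).1, fun e _ => Finset.subset_univ _,
    fun e he => hC e (hEm he).1 (hEm he).2,
    fun e he => by rw [Fintype.card_fin]; exact hCdeg e (hEm he).1 (hEm he).2, ?_⟩, rfl, ?_⟩
  · intro e he e' he' hcol hT
    obtain ⟨x, hx, hxe⟩ := hrep e (e ∩ e') (hEm he).1 hT Finset.inter_subset_left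
    obtain ⟨y, hy, hye⟩ := hrep e' (e ∩ e') (hEm he').1 hT Finset.inter_subset_right
    have h1 := hval (e ∩ e') x hT hx (by rwa [hxe])
    have h2 := hval (e ∩ e') y hT hy (by rwa [hye])
    rw [hxe] at h1
    rw [hye] at h2
    rw [h1, h2, hcol]
  · -- counting
    have hbad := (hD (k - 2) (by omega) (by omega)).1
    rw [show k - (k - 2) = 2 by omega, Fintype.card_fin] at hbad
    have hE0c : (1 - α) * (n.choose (k - 2) : ℝ) ≤ (E0.card : ℝ) := by
      have h1 := Finset.card_filter_add_card_filter_not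
        (s := ((univ : Finset (Fin n)).powersetCard (k - 2))) (fun S => degT k H S ≠ 0)
      rw [Finset.card_powersetCard, Finset.card_univ, Fintype.card_fin] at h1
      have h2 : ((((univ : Finset (Fin n)).powersetCard (k - 2)).filter
          (fun S => ¬ degT k H S ≠ 0)).card : ℝ) ≤ α * (n.choose (k - 2) : ℝ) := by
        refine le_trans ?_ hbad
        rw [← Set.ncard_coe_finset]
        refine Nat.cast_le.2 (Set.ncard_le_ncard ?_ (Set.toFinite _))
        intro S hS
        rw [Finset.mem_coe, Finset.mem_filter, Finset.mem_powersetCard, not_not] at hS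
        refine ⟨hS.1.2, ?_⟩
        rw [hS.2, Nat.cast_zero]
        have h3 : 0 < n.choose 2 := Nat.choose_pos (by omega)
        have h4 : (0 : ℝ) < (n.choose 2 : ℝ) := by exact_mod_cast h3
        have h5 : 0 < 1 - ε := by linarith
        positivity
      have h1R : (E0.card : ℝ) + ((((univ : Finset (Fin n)).powersetCard (k - 2)).filter
          (fun S => ¬ degT k H S ≠ 0)).card : ℝ) = (n.choose (k - 2) : ℝ) := by exact_mod_cast h1
      linarith
    have hch : (n.choose (k - 3) : ℝ) * n ≤ 2 * k * (n.choose (k - 2) : ℝ) := by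
      have h1 := Nat.choose_succ_right_eq n (k - 3)
      rw [show k - 3 + 1 = k - 2 by omega] at h1
      have h2 : n.choose (k - 3) * n ≤ 2 * k * n.choose (k - 2) := by
        calc n.choose (k - 3) * n ≤ n.choose (k - 3) * (2 * (n - (k - 3))) :=
              Nat.mul_le_mul_left _ (by omega)
          _ = 2 * (n.choose (k - 2) * (k - 2)) := by rw [h1]; ring
          _ ≤ 2 * (n.choose (k - 2) * k) := by gcongr; omega
          _ = _ := by ring
      exact_mod_cast h2
    have hDelR : (Del.card : ℝ) ≤ 24 * k * s * (n.choose (k - 2) : ℝ) := by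
      calc (Del.card : ℝ) ≤ (n.choose (k - 3) : ℝ) * (2 * (2 * m)) := by exact_mod_cast hDelc
        _ ≤ (n.choose (k - 3) : ℝ) * (2 * (2 * (3 * s * n))) := by gcongr
        _ = 12 * s * ((n.choose (k - 3) : ℝ) * n) := by ring
        _ ≤ 12 * s * (2 * k * (n.choose (k - 2) : ℝ)) := by gcongr
        _ = _ := by ring
    have h3 : (E0.card : ℝ) ≤ ((E0 \ Del).card : ℝ) + Del.card := by
      exact_mod_cast Finset.card_le_card_sdiff_add_card
    have : (1 - α - 24 * (k : ℝ) * s) * (n.choose (k - 2) : ℝ) ≤ ((E0 \ Del).card : ℝ) := by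
      linarith
    exact this
end

section
/- Let k ≥ 4. There exists α_0 > 0 such that for every 0 < α ≤ α_0 there exists ε_0 > 0 such that for every 0 < ε ≤ ε_0 there exists n_0 such that for all n ≥ n_0 the following holds. Let H be a 2-edge-coloured (1−ε, α)-dense k-graph on n vertices and let G be a 3√ε-blueprint for H. Let R_* be a red tight component and B_* a blue tight component of H, let U ⊆ V(G), and let S be a (k−4)-element subset of U with d_{R_*^{k−2}}(S, U) ≥ ε^{1/4}·n² and d_{B_*^{k−2}}(S, U) ≥ ε^{1/4}·n². Then there exist vertices x, x', y, y' ∈ U ∖ S such that S∪{x,x'} ∈ R_*^{k−2}, S∪{y,y'} ∈ B_*^{k−2}, S∪{x,x',y} ∈ ∂R_*, S∪{x,y,y'} ∈ ∂B_*, and S∪{x,x',y,y'} is an edge of H. In particular, (R_*^{k−2})^+[U] ∪ (B_*^{k−2})^+[U] has an edge. -/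
open Finset

lemma s13_degT {V : Type*} [Fintype V] [DecidableEq V] (m : ℕ) (H : Finset (Finset V))
    (e : Finset V) (h : m - e.card = 1) :
    degT m H e = (univ.filter (fun y => insert y e ∈ H)).card := by
  unfold degT degOn
  rw [h, Finset.powersetCard_one, Finset.filter_map, Finset.card_map]
  congr 1

lemma s13_compl {V : Type*} [Fintype V] (p : V → Prop) [DecidablePred p] (d : ℝ)
    (h : (1 - d) * (Fintype.card V : ℝ) ≤ ((univ.filter p).card : ℝ)) :
    ((univ.filter (fun y => ¬ p y)).card : ℝ) ≤ d * Fintype.card V := by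
  have := Finset.card_filter_add_card_filter_not (s := (univ : Finset V)) p
  rw [Finset.card_univ] at this
  have h2 : ((univ.filter p).card : ℝ) + ((univ.filter (fun y => ¬ p y)).card : ℝ)
      = Fintype.card V := by exact_mod_cast this
  linarith

open Classical in
lemma s13_count {V : Type*} [Fintype V] (P Q : Finset (V × V))
    (T T' : V → V → V → Prop) (E : V → V → V → V → Prop) (c : ℝ) (hc : 0 < c) (hc' : c ≤ 1 / 8)
    (hn : 0 < (Fintype.card V : ℝ))
    (hP : c * (Fintype.card V : ℝ) ^ 2 ≤ P.card) (hQ : c * (Fintype.card V : ℝ) ^ 2 ≤ Q.card)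
    (h1 : ∀ p ∈ P, ((univ.filter (fun y => ¬ T p.1 p.2 y)).card : ℝ) ≤ 3 * c ^ 2 * Fintype.card V)
    (h2 : ∀ q ∈ Q, ((univ.filter (fun x => ¬ T' q.1 q.2 x)).card : ℝ) ≤ 3 * c ^ 2 * Fintype.card V)
    (h3 : ∀ p ∈ P, ∀ y, T p.1 p.2 y →
      ((univ.filter (fun y' => ¬ E p.1 p.2 y y')).card : ℝ) ≤ c ^ 4 * Fintype.card V) :
    ∃ p ∈ P, ∃ q ∈ Q, T p.1 p.2 q.1 ∧ T' q.1 q.2 p.1 ∧ E p.1 p.2 q.1 q.2 := by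
  by_contra hcon
  push Not at hcon
  set N : ℝ := (Fintype.card V : ℝ) with hN
  have k1 : ∀ p ∈ P, (∑ q ∈ Q, if ¬ T p.1 p.2 q.1 then (1 : ℝ) else 0) ≤ 3 * c ^ 2 * N * N := by
    intro p hp
    calc (∑ q ∈ Q, if ¬ T p.1 p.2 q.1 then (1 : ℝ) else 0)
        ≤ ∑ q : V × V, if ¬ T p.1 p.2 q.1 then (1 : ℝ) else 0 :=
          Finset.sum_le_univ_sum_of_nonneg (fun q => by split_ifs <;> norm_num)
      _ = ((univ.filter (fun y => ¬ T p.1 p.2 y)).card : ℝ) * N := by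
          rw [Fintype.sum_prod_type, Finset.card_filter]
          rw [Nat.cast_sum, Finset.sum_mul]
          refine Finset.sum_congr rfl fun x _ => ?_
          by_cases hT : T p.1 p.2 x <;> simp [hT, hN]
      _ ≤ _ := by have := h1 p hp; gcongr
  have k2 : ∀ q ∈ Q, (∑ p ∈ P, if ¬ T' q.1 q.2 p.1 then (1 : ℝ) else 0) ≤ 3 * c ^ 2 * N * N := by
    intro p hp
    calc (∑ q ∈ P, if ¬ T' p.1 p.2 q.1 then (1 : ℝ) else 0)
        ≤ ∑ q : V × V, if ¬ T' p.1 p.2 q.1 then (1 : ℝ) else 0 :=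
          Finset.sum_le_univ_sum_of_nonneg (fun q => by split_ifs <;> norm_num)
      _ = ((univ.filter (fun y => ¬ T' p.1 p.2 y)).card : ℝ) * N := by
          rw [Fintype.sum_prod_type, Finset.card_filter]
          rw [Nat.cast_sum, Finset.sum_mul]
          refine Finset.sum_congr rfl fun x _ => ?_
          by_cases hT : T' p.1 p.2 x <;> simp [hT, hN]
      _ ≤ _ := by have := h2 p hp; gcongr
  have k3 : ∀ p ∈ P, (∑ q ∈ Q, if T p.1 p.2 q.1 ∧ ¬ E p.1 p.2 q.1 q.2 then (1 : ℝ) else 0)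
      ≤ c ^ 4 * N * N := by
    intro p hp
    calc (∑ q ∈ Q, if T p.1 p.2 q.1 ∧ ¬ E p.1 p.2 q.1 q.2 then (1 : ℝ) else 0)
        ≤ ∑ q : V × V, if T p.1 p.2 q.1 ∧ ¬ E p.1 p.2 q.1 q.2 then (1 : ℝ) else 0 :=
          Finset.sum_le_univ_sum_of_nonneg (fun q => by split_ifs <;> norm_num)
      _ ≤ ∑ y : V, c ^ 4 * N := by
          rw [Fintype.sum_prod_type]
          refine Finset.sum_le_sum fun y _ => ?_
          by_cases hT : T p.1 p.2 y
          · have := h3 p hp y hT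
            rw [Finset.card_filter] at this
            push_cast at this
            simpa [hT] using this
          · simp only [hT, false_and, if_false, Finset.sum_const_zero]
            positivity
      _ = _ := by
          simp only [Finset.sum_const, Finset.card_univ, nsmul_eq_mul]
          rw [mul_comm]
  have tot : (P.card : ℝ) * Q.card ≤ P.card * (3 * c ^ 2 * N * N) + Q.card * (3 * c ^ 2 * N * N)
      + P.card * (c ^ 4 * N * N) := by
    calc (P.card : ℝ) * Q.card = ∑ p ∈ P, ∑ q ∈ Q, (1 : ℝ) := by simp
      _ ≤ ∑ p ∈ P, ∑ q ∈ Q, ((if ¬ T p.1 p.2 q.1 then (1 : ℝ) else 0)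
          + (if ¬ T' q.1 q.2 p.1 then (1 : ℝ) else 0)
          + (if T p.1 p.2 q.1 ∧ ¬ E p.1 p.2 q.1 q.2 then (1 : ℝ) else 0)) := by
          refine Finset.sum_le_sum fun p hp => Finset.sum_le_sum fun q hq => ?_
          have := hcon p hp q hq
          by_cases a : T p.1 p.2 q.1 <;> by_cases b : T' q.1 q.2 p.1 <;>
            by_cases d : E p.1 p.2 q.1 q.2 <;> simp_all
      _ = (∑ p ∈ P, ∑ q ∈ Q, (if ¬ T p.1 p.2 q.1 then (1 : ℝ) else 0))
          + (∑ q ∈ Q, ∑ p ∈ P, (if ¬ T' q.1 q.2 p.1 then (1 : ℝ) else 0))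
          + ∑ p ∈ P, ∑ q ∈ Q, (if T p.1 p.2 q.1 ∧ ¬ E p.1 p.2 q.1 q.2 then (1 : ℝ) else 0) := by
          rw [Finset.sum_comm (s := Q)]
          simp only [Finset.sum_add_distrib]
      _ ≤ _ := by
          have a1 := Finset.sum_le_sum k1
          have a2 := Finset.sum_le_sum k2
          have a3 := Finset.sum_le_sum k3
          simp only [Finset.sum_const, nsmul_eq_mul] at a1 a2 a3
          linarith
  have hN2 : 0 < N ^ 2 := by positivity
  have hp0 : 0 < (P.card : ℝ) := lt_of_lt_of_le (by positivity) hP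
  have hq0 : 0 < (Q.card : ℝ) := lt_of_lt_of_le (by positivity) hQ
  have e1 : (P.card : ℝ) * (c * N ^ 2) ≤ P.card * Q.card := by gcongr
  have e2 : (c * N ^ 2) * (Q.card : ℝ) ≤ P.card * Q.card := by gcongr
  have hc1 : 3 * c ^ 2 + c ^ 4 < c / 2 := by
    have : c ^ 2 ≤ c * (1 / 8) := by nlinarith
    have : c ^ 4 ≤ c * (1 / 64) := by nlinarith [sq_nonneg c]
    nlinarith
  have e3 : (3 * c ^ 2 + c ^ 4) * (N ^ 2 * (P.card + Q.card)) <
      c / 2 * (N ^ 2 * (P.card + Q.card)) := by gcongr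
  have e4 : 0 < Q.card * (c ^ 4 * N * N) := by positivity
  nlinarith

lemma s13_tc_symm {V : Type*} [DecidableEq V] {k : ℕ} {Hc : Finset (Finset V)} {f g : Finset V}
    (h : TightConn k Hc f g) : TightConn k Hc g f := by
  obtain ⟨t, e, h0, ht, hm, hi⟩ := h
  refine ⟨t, fun i => e (t - i), by simpa using ht, by simpa using h0,
    fun i _ => hm _ (Nat.sub_le _ _), fun i hit => ?_⟩
  have := hi (t - (i + 1)) (by omega)
  rw [show t - (i + 1) + 1 = t - i by omega, Finset.inter_comm] at this
  exact this

lemma s13_tc_cons {V : Type*} [DecidableEq V] {k : ℕ} {Hc : Finset (Finset V)} {g f h : Finset V}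
    (hg : g ∈ Hc) (hgf : (g ∩ f).card = k - 1)
    (H : TightConn k Hc f h) : TightConn k Hc g h := by
  obtain ⟨t, e, h0, ht, hm, hi⟩ := H
  refine ⟨t + 1, fun i => Nat.casesOn i g e, rfl, ht, ?_, ?_⟩
  · rintro (_ | i) hit
    · exact hg
    · exact hm i (by omega)
  · rintro (_ | i) hit
    · simpa [h0] using hgf
    · exact hi i (by omega)

lemma s13_mem {V : Type*} [DecidableEq V] {k : ℕ} {Hc C : Finset (Finset V)} {g f : Finset V}
    (hC : IsTightComponent k Hc C) (hf : f ∈ C)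
    (hg : g ∈ Hc) (hgf : (g ∩ f).card = k - 1) : g ∈ C := by
  obtain ⟨⟨hs, hc⟩, hmax⟩ := hC
  have key : ∀ h ∈ C, TightConn k Hc g h := fun h hh => s13_tc_cons hg hgf (hc f hf h hh)
  have := hmax (insert g C) ⟨Finset.insert_subset hg hs, ?_⟩ (Finset.subset_insert _ _)
  · rw [← this]; exact Finset.mem_insert_self _ _
  · intro a ha b hb
    rcases Finset.mem_insert.1 ha with rfl | ha2
    · rcases Finset.mem_insert.1 hb with rfl | hb
      · exact ⟨0, fun _ => b, rfl, rfl, fun _ _ => hg, fun i hi => by omega⟩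
      · exact key b hb
    · rcases Finset.mem_insert.1 hb with rfl | hb
      · exact s13_tc_symm (key a ha2)
      · exact hc a ha2 b hb

lemma s13_comp {V : Type*} [Fintype V] [DecidableEq V] {k : ℕ} (hk : 1 ≤ k)
    {Hc C : Finset (Finset V)}
    {g s : Finset V} (hcard : ∀ e ∈ Hc, e.card = k)
    (hC : IsTightComponent k Hc C) (hs : s ∈ shadowTo (k - 1) C)
    (hg : g ∈ Hc) (hsg : s ⊆ g) : g ∈ C := by
  simp only [shadowTo, Finset.mem_filter, Finset.mem_powersetCard] at hs
  obtain ⟨⟨_, hsc⟩, f, hf, hsf⟩ := hs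
  by_cases hgf : g = f
  · rwa [hgf]
  refine s13_mem hC hf hg (le_antisymm ?_ ?_)
  · by_contra hlt
    have h1 : (g ∩ f).card ≤ g.card := Finset.card_le_card Finset.inter_subset_left
    have hgc := hcard g hg
    have hfc := hcard f (hC.1.1 hf)
    have h2 : g ∩ f = g := Finset.eq_of_subset_of_card_le Finset.inter_subset_left (by omega)
    have h3 : g ∩ f = f := Finset.eq_of_subset_of_card_le Finset.inter_subset_right (by omega)
    exact hgf (h2.symm.trans h3)
  · rw [← hsc]; exact Finset.card_le_card (Finset.subset_inter hsg hsf)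

lemma s13_pairs {V : Type*} [Fintype V] [DecidableEq V] {k : ℕ} (hk : 4 ≤ k)
    (R : Finset (Finset V)) (hR : ∀ e ∈ R, e.card = k - 2) (S U : Finset V)
    (hS : S.card = k - 4) :
    degOn (k - 2) R S U ≤ (univ.filter (fun p : V × V => p.1 ∈ U \ S ∧ p.2 ∈ U \ S ∧
      S ∪ {p.1, p.2} ∈ R)).card := by
  unfold degOn
  refine (Finset.card_le_card (t := (univ.filter (fun p : V × V => p.1 ∈ U \ S ∧ p.2 ∈ U \ S ∧
      S ∪ {p.1, p.2} ∈ R)).image (fun p => {p.1, p.2})) ?_).trans Finset.card_image_le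
  intro e he
  simp only [Finset.mem_filter, Finset.mem_powersetCard] at he
  obtain ⟨⟨heU, hec⟩, heR⟩ := he
  rw [hS] at hec
  have hc2 : e.card = 2 := by omega
  have hd : Disjoint e S := by
    rw [← Finset.card_union_eq_card_add_card, hR _ heR]; omega
  obtain ⟨x, y, hxy, rfl⟩ := Finset.card_eq_two.1 hc2
  refine Finset.mem_image.2 ⟨(x, y), ?_, rfl⟩
  rw [Finset.disjoint_left] at hd
  simp only [Finset.mem_filter, Finset.mem_univ, true_and, Finset.mem_sdiff]
  refine ⟨⟨heU (by simp), hd (by simp)⟩, ⟨heU (by simp), hd (by simp)⟩, ?_⟩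
  rwa [Finset.union_comm]

/-- Lemma 5.4 of the paper: for `k ≥ 4`, suitable `0 < ε ≪ α` and large `n`, if `H` is a
2-edge-coloured `(1-ε, α)`-dense `k`-graph on `n` vertices, `G` is a `3√ε`-blueprint for `H`,
`Rs` is a red and `Bs` a blue tight component of `H`, `U ⊆ V(G)`, and `S` is a `(k-4)`-subset
of `U` with `d_{Rs^{k-2}}(S, U), d_{Bs^{k-2}}(S, U) ≥ ε^{1/4} n²`, then there are
`x, x', y, y' ∈ U \ S` with `S ∪ {x,x'} ∈ Rs^{k-2}`, `S ∪ {y,y'} ∈ Bs^{k-2}`,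
`S ∪ {x,x',y} ∈ ∂Rs`, `S ∪ {x,y,y'} ∈ ∂Bs` and `S ∪ {x,x',y,y'} ∈ H`; in particular
`(Rs^{k-2})⁺[U] ∪ (Bs^{k-2})⁺[U]` has an edge. -/
theorem stmt13 (k : ℕ) (hk : 4 ≤ k) :
    ∃ α₀ : ℝ, 0 < α₀ ∧ ∀ α : ℝ, 0 < α → α ≤ α₀ →
      ∃ ε₀ : ℝ, 0 < ε₀ ∧ ∀ ε : ℝ, 0 < ε → ε ≤ ε₀ →
        ∃ n₀ : ℕ, ∀ n : ℕ, n₀ ≤ n →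
          ∀ (H : Finset (Finset (Fin n))) (cH : Finset (Fin n) → Bool),
            (∀ e ∈ H, e.card = k) → IsDense k H (1 - ε) α →
            ∀ (G : Blueprint k H cH (3 * Real.sqrt ε)) (Rs Bs : Finset (Finset (Fin n))),
              IsTightComponent k (H.filter (fun f => cH f = true)) Rs →
              IsTightComponent k (H.filter (fun f => cH f = false)) Bs →
              ∀ U : Finset (Fin n), U ⊆ G.verts →
                ∀ S : Finset (Fin n), S ⊆ U → S.card = k - 4 →
                  ε ^ ((1 : ℝ) / 4) * (n : ℝ) ^ 2 ≤
                    (degOn (k - 2) (G.edges.filter (fun e => G.comp e = Rs)) S U : ℝ) →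
                  ε ^ ((1 : ℝ) / 4) * (n : ℝ) ^ 2 ≤
                    (degOn (k - 2) (G.edges.filter (fun e => G.comp e = Bs)) S U : ℝ) →
                  (∃ x x' y y' : Fin n, x ∈ U \ S ∧ x' ∈ U \ S ∧ y ∈ U \ S ∧ y' ∈ U \ S ∧
                    S ∪ {x, x'} ∈ G.edges.filter (fun e => G.comp e = Rs) ∧
                    S ∪ {y, y'} ∈ G.edges.filter (fun e => G.comp e = Bs) ∧
                    S ∪ {x, x', y} ∈ shadowTo (k - 1) Rs ∧
                    S ∪ {x, y, y'} ∈ shadowTo (k - 1) Bs ∧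
                    S ∪ {x, x', y, y'} ∈ H) ∧
                  ((G.plus (G.edges.filter (fun e => G.comp e = Rs))).filter
                      (fun f => f ⊆ U) ∪
                    (G.plus (G.edges.filter (fun e => G.comp e = Bs))).filter
                      (fun f => f ⊆ U)).Nonempty := by
  refine ⟨1, one_pos, fun α _ _ => ⟨(1 / 8) ^ 4, by positivity, fun ε hε hε' => ⟨1, ?_⟩⟩⟩
  intro n hn H cH hH hD G Rs Bs hRs hBs U hU S hSU hS hR hB
  set c : ℝ := ε ^ ((1 : ℝ) / 4) with hcdef
  have hc0 : 0 < c := Real.rpow_pos_of_pos hε _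
  have hc4 : c ^ 4 = ε := by
    rw [hcdef, ← Real.rpow_natCast, ← Real.rpow_mul hε.le]; norm_num
  have hc8 : c ≤ 1 / 8 := by
    rw [← hc4] at hε'
    exact le_of_pow_le_pow_left₀ (by norm_num) (by norm_num) hε'
  have hsq : Real.sqrt ε = c ^ 2 := by
    rw [← hc4, show c ^ 4 = (c ^ 2) ^ 2 by ring, Real.sqrt_sq (by positivity)]
  have hn0 : (0 : ℝ) < n := by exact_mod_cast hn
  have hGc : ∀ C : Finset (Finset (Fin n)), ∀ e ∈ G.edges.filter (fun e => G.comp e = C),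
      e.card = k - 2 := fun C e he => G.edges_card e (Finset.mem_filter.1 he).1
  have hP := s13_pairs hk _ (hGc Rs) S U hS
  have hQ := s13_pairs hk _ (hGc Bs) S U hS
  have hshad : ∀ C : Finset (Finset (Fin n)), ∀ e ∈ G.edges.filter (fun e => G.comp e = C),
      ((univ.filter (fun y => ¬ insert y e ∈ shadowTo (k - 1) C)).card : ℝ)
        ≤ 3 * c ^ 2 * Fintype.card (Fin n) := by
    intro C e he
    have hec := hGc C e he
    obtain ⟨he1, he2⟩ := Finset.mem_filter.1 he
    have := G.comp_deg e he1
    rw [he2, s13_degT _ _ _ (by omega), hsq] at this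
    exact s13_compl _ _ this
  have main := s13_count _ _
    (fun x x' y => insert y (S ∪ {x, x'}) ∈ shadowTo (k - 1) Rs)
    (fun y y' x => insert x (S ∪ {y, y'}) ∈ shadowTo (k - 1) Bs)
    (fun x x' y y' => insert y' (insert y (S ∪ {x, x'})) ∈ H) c hc0 hc8
    (by simpa using hn0)
    (by rw [Fintype.card_fin]; exact hR.trans (by exact_mod_cast hP))
    (by rw [Fintype.card_fin]; exact hB.trans (by exact_mod_cast hQ))
    (fun p hp => by
      have := hshad Rs _ (Finset.mem_filter.1 hp).2.2.2
      convert this)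
    (fun p hp => by
      have := hshad Bs _ (Finset.mem_filter.1 hp).2.2.2
      convert this)
    (fun p hp y hT => by
      simp only [shadowTo, Finset.mem_filter, Finset.mem_powersetCard] at hT
      obtain ⟨⟨_, hcd⟩, f, hf, hsf⟩ := hT
      have hfH : f ∈ H := (Finset.mem_filter.1 (hRs.1.1 hf)).1
      have hfk := hH f hfH
      have hd := (hD (k - 1) (by omega) le_rfl).2 _ hcd
      rw [show k - (k - 1) = 1 by omega, Nat.choose_one_right,
        s13_degT _ _ _ (by omega)] at hd
      rw [hc4]
      have hge : (1 - ε) * (Fintype.card (Fin n) : ℝ) ≤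
          ((univ.filter (fun y' => insert y' (insert y (S ∪ {p.1, p.2})) ∈ H)).card : ℝ) := by
        by_contra hlt
        have h0 := hd (not_le.1 hlt)
        have hdiff : (f \ (insert y (S ∪ {p.1, p.2}))).card = 1 := by
          rw [Finset.card_sdiff_of_subset hsf]; omega
        obtain ⟨z, hz⟩ := Finset.card_eq_one.1 hdiff
        have hzf : insert z (insert y (S ∪ {p.1, p.2})) = f := by
          rw [Finset.insert_eq, ← hz, Finset.sdiff_union_of_subset hsf]
        have hzm : z ∈ univ.filter (fun y' => insert y' (insert y (S ∪ {p.1, p.2})) ∈ H) := by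
          rw [Finset.mem_filter]; exact ⟨Finset.mem_univ _, by rw [hzf]; exact hfH⟩
        rw [Finset.card_eq_zero.1 h0] at hzm
        simp at hzm
      have := s13_compl _ _ hge
      convert this)
  obtain ⟨⟨x, x'⟩, hp, ⟨y, y'⟩, hq, hT, hT', hE⟩ := main
  simp only [Finset.mem_filter, Finset.mem_univ, true_and] at hp hq
  dsimp only at hT hT' hE
  have q1 : insert y (S ∪ {x, x'}) = S ∪ {x, x', y} := by ext; simp; tauto
  have q2 : insert x (S ∪ {y, y'}) = S ∪ {x, y, y'} := by ext; simp <;> tauto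
  have q3 : insert y' (insert y (S ∪ {x, x'})) = S ∪ {x, x', y, y'} := by ext; simp; tauto
  rw [q1] at hT
  rw [q2] at hT'
  rw [q3] at hE
  obtain ⟨hx, hx', hxe⟩ := hp
  obtain ⟨hy, hy', hye⟩ := hq
  refine ⟨⟨x, x', y, y', hx, hx', hy, hy', Finset.mem_filter.2 hxe, Finset.mem_filter.2 hye,
    hT, hT', hE⟩, S ∪ {x, x', y, y'}, ?_⟩
  have hgU : S ∪ {x, x', y, y'} ⊆ U := by
    rw [Finset.mem_sdiff] at hx hx' hy hy'
    refine Finset.union_subset hSU ?_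
    intro z hz
    simp only [Finset.mem_insert, Finset.mem_singleton] at hz
    rcases hz with rfl | rfl | rfl | rfl
    exacts [hx.1, hx'.1, hy.1, hy'.1]
  have fin : ∀ (b : Bool) (C s e : Finset _), IsTightComponent k (H.filter (fun f => cH f = b)) C →
      cH (S ∪ {x, x', y, y'}) = b → s ∈ shadowTo (k - 1) C → s ⊆ S ∪ {x, x', y, y'} →
      e ∈ G.edges → G.comp e = C → e ⊆ S ∪ {x, x', y, y'} →
      S ∪ {x, x', y, y'} ∈ (G.plus (G.edges.filter (fun e => G.comp e = C))).filter
        (fun f => f ⊆ U) := by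
    intro b C s e hC hb hs hsg he heC heg
    have hgC := s13_comp (by omega) (fun e he => hH e (Finset.mem_filter.1 he).1) hC hs
      (Finset.mem_filter.2 ⟨hE, hb⟩) hsg
    have hem : e ∈ G.edges.filter (fun e => G.comp e = C) := Finset.mem_filter.2 ⟨he, heC⟩
    refine Finset.mem_filter.2 ⟨Finset.mem_filter.2 ⟨Finset.mem_biUnion.2 ⟨e, hem, ?_⟩,
      e, hem, heg⟩, hgU⟩
    rw [heC]; exact hgC
  rw [Finset.mem_union]
  cases hcol : cH (S ∪ {x, x', y, y'}) with
  | true =>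
    left
    refine fin true Rs _ _ hRs hcol hT ?_ hxe.1 hxe.2 ?_ <;> intro z <;> simp <;> tauto
  | false =>
    right
    refine fin false Bs _ _ hBs hcol hT' ?_ hye.1 hye.2 ?_ <;> intro z <;> simp <;> tauto
end
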